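/- arXiv:1608.01405 — 5 statements merged into one kernel-verified Lean document; each statement's English description precedes it below -/
import Mathlib

section
/- The relation ⊑L+ on Δⁿ, defined by x ⊑L+ y iff x⁺·y_k ≤ y⁺·x_k for all k, is a partial order: it is reflexive, transitive and antisymmetric. -/
/-- `x` is a point of the probability simplex `Δⁿ`. -/
def IsDist {n : ℕ} (x : Fin n → ℝ) : Prop :=
  (∀ k, 0 ≤ x k) ∧ ∑ k, x k = 1

/-- `x⁺`, the largest coordinate of `x`. -/
noncomputable def maxCoord {n : ℕ} (x : Fin n → ℝ) : ℝ :=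
  sSup (Set.range x)

/-- The renormalised Löwner order `⊑L+`: `x ⊑L+ y` iff `x⁺ · y_k ≤ y⁺ · x_k` for all `k`. -/
def LowPlus {n : ℕ} (x y : Fin n → ℝ) : Prop :=
  ∀ k, maxCoord x * y k ≤ maxCoord y * x k

/-- The largest coordinate of a point of the simplex is positive. -/
theorem IsDist.maxCoord_pos {n : ℕ} {x : Fin n → ℝ} (hx : IsDist x) : 0 < maxCoord x := by
  obtain ⟨k, hk⟩ : ∃ k, 0 < x k := by
    by_contra! h
    have := Finset.sum_nonpos fun k (_ : k ∈ Finset.univ) => h k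
    linarith [hx.2]
  exact hk.trans_le (le_csSup (Set.finite_range x).bddAbove (Set.mem_range_self k))

/-- `⊑L+` is a partial order on `Δⁿ`: reflexive, transitive and antisymmetric. -/
theorem lowPlus_partialOrder (n : ℕ) (hn : 2 ≤ n) :
    (∀ x : Fin n → ℝ, IsDist x → LowPlus x x) ∧
    (∀ x y z : Fin n → ℝ, IsDist x → IsDist y → IsDist z →
      LowPlus x y → LowPlus y z → LowPlus x z) ∧
    (∀ x y : Fin n → ℝ, IsDist x → IsDist y →
      LowPlus x y → LowPlus y x → x = y) := by
  refine ⟨fun x _ k => le_rfl, fun x y z hx hy hz hxy hyz k => ?_, fun x y hx hy hxy hyx => ?_⟩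
  · refine le_of_mul_le_mul_left ?_ hy.maxCoord_pos
    calc maxCoord y * (maxCoord x * z k) = maxCoord x * (maxCoord y * z k) := by ring
      _ ≤ maxCoord x * (maxCoord z * y k) :=
        mul_le_mul_of_nonneg_left (hyz k) hx.maxCoord_pos.le
      _ = maxCoord z * (maxCoord x * y k) := by ring
      _ ≤ maxCoord z * (maxCoord y * x k) :=
        mul_le_mul_of_nonneg_left (hxy k) hz.maxCoord_pos.le
      _ = maxCoord y * (maxCoord z * x k) := by ring
  · have h : ∀ k, maxCoord x * y k = maxCoord y * x k := fun k => le_antisymm (hxy k) (hyx k)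
    have hmax : maxCoord x = maxCoord y := by
      have hsum : ∑ k, maxCoord x * y k = ∑ k, maxCoord y * x k :=
        Finset.sum_congr rfl fun k _ => h k
      rwa [← Finset.mul_sum, ← Finset.mul_sum, hx.2, hy.2, mul_one, mul_one] at hsum
    funext k
    refine mul_left_cancel₀ hy.maxCoord_pos.ne' ?_
    rw [← h k, hmax]
end

section
/- The partial order ⊑L+ is an information ordering on Δⁿ: (i) it is permutation invariant, i.e. x ⊑L+ y implies σ(x) ⊑L+ σ(y) for every permutation σ of coordinates; (ii) it allows mixing, i.e. x ⊑L+ y implies x ⊑L+ (1−t)x + ty ⊑L+ y for all t ∈ [0,1]; (iii) the uniform distribution ⊥ = (1/n,…,1/n) satisfies ⊥ ⊑L+ x for every x ∈ Δⁿ; (iv) every x ∈ Δⁿ satisfies x ⊑L+ ⊤_i for some i, where ⊤_i is the pointed distribution with i-th coordinate 1 and the others 0, and each ⊤_i is maximal (⊤_i ⊑L+ y implies y = ⊤_i). -/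
theorem maxCoord_eq_of_forall_le {n : ℕ} {x : Fin n → ℝ} {i : Fin n} (h : ∀ k, x k ≤ x i) :
    maxCoord x = x i :=
  IsGreatest.csSup_eq ⟨⟨i, rfl⟩, by rintro _ ⟨k, rfl⟩; exact h k⟩

theorem le_maxCoord {n : ℕ} (x : Fin n → ℝ) (k : Fin n) : x k ≤ maxCoord x :=
  le_csSup (Set.finite_range x).bddAbove ⟨k, rfl⟩

theorem exists_eq_maxCoord {n : ℕ} [NeZero n] (x : Fin n → ℝ) : ∃ i, x i = maxCoord x := by
  obtain ⟨i, hi⟩ := Finite.exists_max x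
  exact ⟨i, (maxCoord_eq_of_forall_le hi).symm⟩

theorem maxCoord_comp_perm {n : ℕ} (x : Fin n → ℝ) (σ : Equiv.Perm (Fin n)) :
    maxCoord (x ∘ σ) = maxCoord x := by
  unfold maxCoord
  rw [σ.surjective.range_comp]

theorem maxCoord_pointed {n : ℕ} (i : Fin n) :
    maxCoord (fun k => if k = i then (1 : ℝ) else 0) = 1 := by
  rw [maxCoord_eq_of_forall_le (i := i)]
  · simp
  · intro k
    by_cases h : k = i <;> simp [h]

/-- If `x ⊑L+ y`, the largest coordinate is affine along the segment from `x` to `y`. -/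
theorem LowPlus.maxCoord_mix {n : ℕ} [NeZero n] {x y : Fin n → ℝ} (hy : IsDist y)
    (h : LowPlus x y) {t : ℝ} (ht : t ∈ Set.Icc (0 : ℝ) 1) :
    maxCoord (fun k => (1 - t) * x k + t * y k) = (1 - t) * maxCoord x + t * maxCoord y := by
  obtain ⟨m, hm⟩ := exists_eq_maxCoord y
  have hxm : x m = maxCoord x := by
    refine le_antisymm (le_maxCoord x m) (le_of_mul_le_mul_left ?_ hy.maxCoord_pos)
    have := h m
    rw [hm] at this
    linarith
  rw [maxCoord_eq_of_forall_le (i := m)]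
  · simp only [hxm, hm]
  · intro k
    simp only [hxm, hm]
    exact add_le_add (mul_le_mul_of_nonneg_left (le_maxCoord x k) (by linarith [ht.2]))
      (mul_le_mul_of_nonneg_left (le_maxCoord y k) ht.1)

/-- `⊑L+` is an information ordering on `Δⁿ`: it is permutation invariant, allows mixing,
has the uniform distribution as least element, and every element lies below some pointed
distribution `⊤ᵢ`, each of which is maximal. -/
theorem lowPlus_informationOrdering (n : ℕ) (hn : 2 ≤ n) :
    -- (i) permutation invariance
    (∀ x y : Fin n → ℝ, IsDist x → IsDist y → ∀ σ : Equiv.Perm (Fin n),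
      LowPlus x y → LowPlus (x ∘ σ) (y ∘ σ)) ∧
    -- (ii) mixing
    (∀ x y : Fin n → ℝ, IsDist x → IsDist y → LowPlus x y → ∀ t ∈ Set.Icc (0:ℝ) 1,
      LowPlus x (fun k => (1 - t) * x k + t * y k) ∧
      LowPlus (fun k => (1 - t) * x k + t * y k) y) ∧
    -- (iii) the uniform distribution is below everything
    (∀ x : Fin n → ℝ, IsDist x → LowPlus (fun _ => (1 : ℝ) / n) x) ∧
    -- (iv) every element is below some pointed distribution, and each ⊤ᵢ is maximal
    (∀ x : Fin n → ℝ, IsDist x →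
      ∃ i : Fin n, LowPlus x (fun k => if k = i then (1 : ℝ) else 0)) ∧
    (∀ (i : Fin n) (y : Fin n → ℝ), IsDist y →
      LowPlus (fun k => if k = i then (1 : ℝ) else 0) y →
      y = fun k => if k = i then (1 : ℝ) else 0) := by
  have : NeZero n := ⟨by omega⟩
  refine ⟨?_, ?_, ?_, ?_, ?_⟩
  · intro x y _ _ σ h k
    rw [maxCoord_comp_perm, maxCoord_comp_perm]
    exact h (σ k)
  · intro x y _ hy h t ht
    constructor <;> intro k <;> rw [h.maxCoord_mix hy ht]
    · linarith [mul_le_mul_of_nonneg_left (h k) ht.1]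
    · linarith [mul_le_mul_of_nonneg_left (h k) (sub_nonneg.2 ht.2)]
  · intro x _ k
    rw [maxCoord_eq_of_forall_le (i := k) fun _ => le_rfl, mul_comm]
    exact mul_le_mul_of_nonneg_right (le_maxCoord x k) (by positivity)
  · intro x hx
    obtain ⟨i, hi⟩ := exists_eq_maxCoord x
    refine ⟨i, fun k => ?_⟩
    rw [maxCoord_pointed]
    by_cases hk : k = i
    · simp [hk, hi]
    · simpa [hk] using hx.1 k
  · intro i y hy h
    have hzero : ∀ k, k ≠ i → y k = 0 := fun k hk => by
      have hk' := h k
      rw [maxCoord_pointed] at hk'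
      exact le_antisymm (by simpa [hk] using hk') (hy.1 k)
    have hone : y i = 1 := by
      rw [← hy.2, Fintype.sum_eq_single i hzero]
    funext k
    by_cases hk : k = i
    · simp [hk, hone]
    · simp [hk, hzero k hk]
end

section
/- The relation ⊑L− on Δⁿ is a partial order: it is reflexive, transitive and antisymmetric. -/
/-- `x⁻`, the smallest nonzero coordinate of `x`. -/
noncomputable def minPos {n : ℕ} (x : Fin n → ℝ) : ℝ :=
  sInf {a : ℝ | (∃ k, x k = a) ∧ a ≠ 0}

/-- The renormalised Löwner order `⊑L−`: `x ⊑L− y` iff the zero set of `x` is contained in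
that of `y`, and either some coordinate where `y` vanishes carries the smallest nonzero
coordinate of `x`, or the zero sets coincide and `x_k · y⁻ ≤ y_k · x⁻` for all `k` with
`x_k ≠ 0`. -/
def LowMinus {n : ℕ} (x y : Fin n → ℝ) : Prop :=
  {k | x k = 0} ⊆ {k | y k = 0} ∧
  ((∃ k, y k = 0 ∧ x k = minPos x) ∨
   ({k | x k = 0} = {k | y k = 0} ∧
     ∀ k, x k ≠ 0 → x k * minPos y ≤ y k * minPos x))

lemma IsDist.minPos_le {n : ℕ} {x : Fin n → ℝ} (hx : IsDist x) {k : Fin n} (hk : x k ≠ 0) :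
    minPos x ≤ x k := by
  refine csInf_le ⟨0, ?_⟩ ⟨⟨k, rfl⟩, hk⟩
  rintro _ ⟨⟨j, rfl⟩, -⟩
  exact hx.1 j

lemma IsDist.minPos_pos {n : ℕ} {x : Fin n → ℝ} (hx : IsDist x) : 0 < minPos x := by
  have hne : {a : ℝ | (∃ k, x k = a) ∧ a ≠ 0}.Nonempty := by
    obtain ⟨k, -, hk⟩ := Finset.exists_ne_zero_of_sum_ne_zero (hx.2.trans_ne one_ne_zero)
    exact ⟨x k, ⟨k, rfl⟩, hk⟩
  have hfin : {a : ℝ | (∃ k, x k = a) ∧ a ≠ 0}.Finite :=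
    (Set.finite_range x).subset fun _ ha => ha.1
  obtain ⟨⟨k, hk⟩, h0⟩ := hne.csInf_mem hfin
  exact lt_of_le_of_ne ((hx.1 k).trans_eq hk) (Ne.symm h0)

lemma LowMinus.refl {n : ℕ} (x : Fin n → ℝ) : LowMinus x x :=
  ⟨subset_rfl, Or.inr ⟨rfl, fun _ _ => le_rfl⟩⟩

lemma LowMinus.trans {n : ℕ} {x y z : Fin n → ℝ} (hx : IsDist x) (hy : IsDist y)
    (hz : IsDist z) (hxy : LowMinus x y) (hyz : LowMinus y z) : LowMinus x z := by
  obtain ⟨hsub, hxy⟩ := hxy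
  obtain ⟨hsub', hyz⟩ := hyz
  refine ⟨hsub.trans hsub', ?_⟩
  have hxp := hx.minPos_pos
  have hyp := hy.minPos_pos
  have hzp := hz.minPos_pos
  rcases hxy with ⟨k, hyk, hxk⟩ | ⟨heq, hle⟩
  · exact Or.inl ⟨k, hsub' hyk, hxk⟩
  rcases hyz with ⟨k, hzk, hyk⟩ | ⟨heq', hle'⟩
  · have hxk : x k ≠ 0 := fun h => hyp.ne' (hyk.symm.trans (hsub h))
    have h := hle k hxk
    rw [hyk, mul_comm (minPos y)] at h
    exact Or.inl ⟨k, hzk, le_antisymm (le_of_mul_le_mul_right h hyp) (hx.minPos_le hxk)⟩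
  · refine Or.inr ⟨heq.trans heq', fun k hxk => le_of_mul_le_mul_right ?_ hyp⟩
    have hyk : y k ≠ 0 := fun h => hxk (heq.ge h)
    calc x k * minPos z * minPos y = x k * minPos y * minPos z := by ring
      _ ≤ y k * minPos x * minPos z := mul_le_mul_of_nonneg_right (hle k hxk) hzp.le
      _ = y k * minPos z * minPos x := by ring
      _ ≤ z k * minPos y * minPos x := mul_le_mul_of_nonneg_right (hle' k hyk) hxp.le
      _ = z k * minPos x * minPos y := by ring

lemma LowMinus.mul_minPos_le {n : ℕ} {x y : Fin n → ℝ} (hx : IsDist x) (hxy : LowMinus x y)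
    (hyx : {k | y k = 0} ⊆ {k | x k = 0}) (k : Fin n) : x k * minPos y ≤ y k * minPos x := by
  obtain ⟨hsub, ⟨j, hyj, hxj⟩ | ⟨-, hle⟩⟩ := hxy
  · exact absurd (hxj.symm.trans (hyx hyj)) hx.minPos_pos.ne'
  · by_cases hk : x k = 0
    · have hyk : y k = 0 := hsub hk
      simp [hk, hyk]
    · exact hle k hk

lemma LowMinus.antisymm {n : ℕ} {x y : Fin n → ℝ} (hx : IsDist x) (hy : IsDist y)
    (hxy : LowMinus x y) (hyx : LowMinus y x) : x = y := by
  have h : ∀ k, x k * minPos y = y k * minPos x := fun k =>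
    le_antisymm (hxy.mul_minPos_le hx hyx.1 k) (hyx.mul_minPos_le hy hxy.1 k)
  have hmin : minPos y = minPos x := by
    have hsum := Finset.sum_congr (rfl : Finset.univ = Finset.univ) fun k _ => h k
    rwa [← Finset.sum_mul, ← Finset.sum_mul, hx.2, hy.2, one_mul, one_mul] at hsum
  funext k
  have hk := h k
  rw [hmin] at hk
  exact mul_right_cancel₀ hx.minPos_pos.ne' hk

/-- `⊑L−` is a partial order on `Δⁿ`: reflexive, transitive and antisymmetric. -/
theorem lowMinus_partialOrder (n : ℕ) (hn : 2 ≤ n) :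
    (∀ x : Fin n → ℝ, IsDist x → LowMinus x x) ∧
    (∀ x y z : Fin n → ℝ, IsDist x → IsDist y → IsDist z →
      LowMinus x y → LowMinus y z → LowMinus x z) ∧
    (∀ x y : Fin n → ℝ, IsDist x → IsDist y →
      LowMinus x y → LowMinus y x → x = y) :=
  ⟨fun x _ => LowMinus.refl x, fun _ _ _ hx hy hz => LowMinus.trans hx hy hz,
    fun _ _ hx hy => LowMinus.antisymm hx hy⟩
end

section
/- There is a unique information ordering on Δ²: every information ordering ⊑ on Δ² satisfies x ⊑ y if and only if either (1/2 ≤ x₁ and x₁ ≤ y₁) or (x₁ ≤ 1/2 and y₁ ≤ x₁). -/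
/-- `r` is an information ordering on `Δⁿ`: a partial order on `Δⁿ` which is permutation
invariant, allows mixing, has the uniform distribution as least element, and in which every
element lies below some pointed distribution `⊤ᵢ`, each `⊤ᵢ` being maximal. -/
def IsInfoOrder {n : ℕ} (r : (Fin n → ℝ) → (Fin n → ℝ) → Prop) : Prop :=
  (∀ x, IsDist x → r x x) ∧
  (∀ x y z, IsDist x → IsDist y → IsDist z → r x y → r y z → r x z) ∧
  (∀ x y, IsDist x → IsDist y → r x y → r y x → x = y) ∧
  (∀ x y, IsDist x → IsDist y → ∀ σ : Equiv.Perm (Fin n), r x y → r (x ∘ σ) (y ∘ σ)) ∧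
  (∀ x y, IsDist x → IsDist y → r x y → ∀ t ∈ Set.Icc (0:ℝ) 1,
    r x (fun k => (1 - t) * x k + t * y k) ∧ r (fun k => (1 - t) * x k + t * y k) y) ∧
  (∀ x, IsDist x → r (fun _ => (1 : ℝ) / n) x) ∧
  (∀ x, IsDist x → ∃ i, r x (fun k => if k = i then (1 : ℝ) else 0)) ∧
  (∀ (i : Fin n) y, IsDist y → r (fun k => if k = i then (1 : ℝ) else 0) y →
    y = fun k => if k = i then (1 : ℝ) else 0)

theorem IsDist.apply_one {x : Fin 2 → ℝ} (hx : IsDist x) : x 1 = 1 - x 0 := by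
  have h := hx.2
  rw [Fin.sum_univ_two] at h
  linarith

theorem IsDist.ext_fin_two {x y : Fin 2 → ℝ} (hx : IsDist x) (hy : IsDist y) (h : x 0 = y 0) :
    x = y := by
  funext k
  fin_cases k
  · exact h
  · simpa [hx.apply_one, hy.apply_one] using h

theorem isDist_vec_two {a : ℝ} (h0 : 0 ≤ a) (h1 : a ≤ 1) : IsDist ![a, 1 - a] := by
  refine ⟨fun k => ?_, by simp⟩
  fin_cases k
  · simpa using h0
  · simpa using h1

theorem IsDist.le_one {x : Fin 2 → ℝ} (hx : IsDist x) : x 0 ≤ 1 := by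
  have h := hx.1 1
  rw [hx.apply_one] at h
  linarith

/-- Every distribution on two points lying between two comparable ones is comparable to both. -/
theorem IsInfoOrder.between {r : (Fin 2 → ℝ) → (Fin 2 → ℝ) → Prop} (hr : IsInfoOrder r)
    {x y z : Fin 2 → ℝ} (hx : IsDist x) (hy : IsDist y) (hz : IsDist z) (hxy : r x y)
    (h : z 0 ∈ Set.uIcc (x 0) (y 0)) : r x z ∧ r z y := by
  obtain ⟨-, -, -, -, hmix, -⟩ := hr
  rw [← segment_eq_uIcc] at h
  obtain ⟨s, t, hs, ht, hst, he⟩ := h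
  simp only [smul_eq_mul] at he
  obtain rfl : s = 1 - t := by linarith
  have hz' : (fun k => (1 - t) * x k + t * y k) = z := by
    funext k
    fin_cases k
    · exact he
    · simp only [Fin.mk_one, hx.apply_one, hy.apply_one, hz.apply_one]
      linarith
  simpa only [hz'] using hmix x y hx hy hxy t ⟨ht, by linarith⟩

theorem IsInfoOrder.uniform_le {r : (Fin 2 → ℝ) → (Fin 2 → ℝ) → Prop} (hr : IsInfoOrder r)
    {x y : Fin 2 → ℝ} (hx : IsDist x) (hy : IsDist y) (h : x 0 = 1 / 2) : r x y := by
  obtain ⟨-, -, -, -, -, hbot, -⟩ := hr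
  have hu : (fun _ => (1 : ℝ) / (2 : ℕ)) = x := by
    funext k
    fin_cases k
    · simp [h]
    · simp only [Fin.mk_one, hx.apply_one, h]
      norm_num
  simpa only [hu] using hbot y hy

theorem IsInfoOrder.of_mem_uIcc {r : (Fin 2 → ℝ) → (Fin 2 → ℝ) → Prop} (hr : IsInfoOrder r)
    {x y : Fin 2 → ℝ} (hx : IsDist x) (hy : IsDist y) (h : x 0 ∈ Set.uIcc (1 / 2) (y 0)) :
    r x y := by
  have hu : IsDist ![(1 / 2 : ℝ), 1 - 1 / 2] := isDist_vec_two (by norm_num) (by norm_num)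
  exact (hr.between hu hy hx (hr.uniform_le hu hy (by simp)) (by simpa using h)).2

/-- If `x` is below `y`, no distribution other than `x` lies both between `x` and `y` and
between the uniform distribution and `x`. -/
theorem IsInfoOrder.eq_of_mem_uIcc {r : (Fin 2 → ℝ) → (Fin 2 → ℝ) → Prop} (hr : IsInfoOrder r)
    {x y : Fin 2 → ℝ} (hx : IsDist x) (hy : IsDist y) (hxy : r x y) {c : ℝ}
    (hc : c ∈ Set.uIcc (x 0) (y 0)) (hc' : c ∈ Set.uIcc (1 / 2) (x 0)) : x 0 = c := by
  have hcd : IsDist ![c, 1 - c] := isDist_vec_two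
    ((le_inf (hx.1 0) (hy.1 0)).trans hc.1) (hc.2.trans (sup_le hx.le_one hy.le_one))
  have h := hr.2.2.1 x _ hx hcd (hr.between hx hy hcd hxy (by simpa using hc)).1
    (hr.of_mem_uIcc hcd hx (by simpa using hc'))
  simpa using congrFun h 0

/-- There is a unique information ordering on `Δ²`: any information ordering `⊑` on `Δ²`
satisfies `x ⊑ y` iff either `1/2 ≤ x₁ ∧ x₁ ≤ y₁`, or `x₁ ≤ 1/2 ∧ y₁ ≤ x₁`. -/
theorem infoOrder_unique_on_delta2
    (r : (Fin 2 → ℝ) → (Fin 2 → ℝ) → Prop) (hr : IsInfoOrder r) :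
    ∀ x y : Fin 2 → ℝ, IsDist x → IsDist y →
      (r x y ↔ ((1 / 2 ≤ x 0 ∧ x 0 ≤ y 0) ∨ (x 0 ≤ 1 / 2 ∧ y 0 ≤ x 0))) := by
  intro x y hx hy
  constructor
  · intro hxy
    rcases le_total (1 / 2) (x 0) with h | h
    · rcases le_or_gt (x 0) (y 0) with h' | h'
      · exact Or.inl ⟨h, h'⟩
      · have e := hr.eq_of_mem_uIcc hx hy hxy (c := max (y 0) (1 / 2))
          (Set.mem_uIcc.2 (Or.inr ⟨le_max_left _ _, max_le h'.le h⟩))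
          (Set.mem_uIcc.2 (Or.inl ⟨le_max_right _ _, max_le h'.le h⟩))
        grind
    · rcases le_or_gt (y 0) (x 0) with h' | h'
      · exact Or.inr ⟨h, h'⟩
      · have e := hr.eq_of_mem_uIcc hx hy hxy (c := min (y 0) (1 / 2))
          (Set.mem_uIcc.2 (Or.inl ⟨le_min h'.le h, min_le_left _ _⟩))
          (Set.mem_uIcc.2 (Or.inr ⟨le_min h'.le h, min_le_right _ _⟩))
        grind
  · rintro (⟨h, h'⟩ | ⟨h, h'⟩)
    · exact hr.of_mem_uIcc hx hy (Set.mem_uIcc.2 (Or.inl ⟨h, h'⟩))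
    · exact hr.of_mem_uIcc hx hy (Set.mem_uIcc.2 (Or.inr ⟨h', h⟩))
end

section
/- Let ⊑ be a partial order on Λⁿ satisfying the degeneracy condition and the support condition (x ⊑ y and x_k = 0 imply y_k = 0). Define a relation ⊑' on Δⁿ by: x ⊑' y iff there exists a permutation σ of coordinates with σ(x) ∈ Λⁿ, σ(y) ∈ Λⁿ and σ(x) ⊑ σ(y). Then ⊑' is a partial order on Δⁿ (reflexive, transitive and antisymmetric), and it is permutation invariant. -/
/-- `x` lies in the monotone sector `Λⁿ`: a point of `Δⁿ` with decreasing coordinates. -/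
def IsMono {n : ℕ} (x : Fin n → ℝ) : Prop :=
  IsDist x ∧ ∀ i j : Fin n, i ≤ j → x j ≤ x i

/-- The extension `⊑'` to `Δⁿ` of a relation `⊑` on `Λⁿ`: `x ⊑' y` iff some permutation
simultaneously brings `x` and `y` into `Λⁿ`, where they are related by `⊑`. -/
def extOrd {n : ℕ} (r : (Fin n → ℝ) → (Fin n → ℝ) → Prop) (x y : Fin n → ℝ) : Prop :=
  ∃ σ : Equiv.Perm (Fin n), IsMono (x ∘ σ) ∧ IsMono (y ∘ σ) ∧ r (x ∘ σ) (y ∘ σ)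

theorem IsDist.comp_perm {n : ℕ} {x : Fin n → ℝ} (hx : IsDist x) (σ : Equiv.Perm (Fin n)) :
    IsDist (x ∘ σ) :=
  ⟨fun k => hx.1 (σ k), (Equiv.sum_comp σ x).trans hx.2⟩

/-- Every point of the simplex can be sorted into the monotone sector. -/
theorem IsDist.exists_isMono_comp {n : ℕ} {x : Fin n → ℝ} (hx : IsDist x) :
    ∃ σ : Equiv.Perm (Fin n), IsMono (x ∘ σ) :=
  ⟨Tuple.sort (-x), hx.comp_perm _,
    fun _ _ hij => neg_le_neg_iff.mp (Tuple.monotone_sort (-x) hij)⟩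

/-- The decreasing rearrangement of a point is unique. -/
theorem IsMono.comp_perm_unique {n : ℕ} {x : Fin n → ℝ} {σ τ : Equiv.Perm (Fin n)}
    (hσ : IsMono (x ∘ σ)) (hτ : IsMono (x ∘ τ)) : x ∘ σ = x ∘ τ :=
  Tuple.unique_antitone (fun i j hij => hσ.2 i j hij) (fun i j hij => hτ.2 i j hij)

/-- Two permutations giving the same rearrangement of `y` can be glued along a set of values
of `y`. -/
theorem exists_perm_glue {α β : Type*} [Finite α] {y : α → β} {σ τ : Equiv.Perm α}
    (h : y ∘ σ = y ∘ τ) (p : β → Prop) :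
    ∃ ρ : Equiv.Perm α, (∀ k, p (y (σ k)) → ρ k = σ k) ∧ (∀ k, ¬ p (y (σ k)) → ρ k = τ k) := by
  classical
  have hy : ∀ k, y (σ k) = y (τ k) := congrFun h
  let f : α → α := fun k => if p (y (σ k)) then σ k else τ k
  have hyf : ∀ k, y (f k) = y (σ k) := by
    intro k
    by_cases hk : p (y (σ k))
    · simp only [f, if_pos hk]
    · simp only [f, if_neg hk, hy k]
  have hf : Function.Injective f := by
    intro i j hij
    have hv : y (σ i) = y (σ j) := by rw [← hyf i, ← hyf j, hij]
    by_cases hj : p (y (σ j)) <;> simpa [f, hv, hj] using hij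
  exact ⟨Equiv.ofBijective f (Finite.injective_iff_bijective.mp hf),
    fun _ hk => if_pos hk, fun _ hk => if_neg hk⟩

/-- Let `⊑` be a partial order on `Λⁿ` satisfying the degeneracy condition and the support
condition.  Then its extension `⊑'` to `Δⁿ` is a partial order on `Δⁿ`, and it is
permutation invariant. -/
theorem extOrd_partialOrder (n : ℕ) (hn : 2 ≤ n)
    (r : (Fin n → ℝ) → (Fin n → ℝ) → Prop)
    (hrefl : ∀ x, IsMono x → r x x)
    (htrans : ∀ x y z, IsMono x → IsMono y → IsMono z → r x y → r y z → r x z)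
    (hanti : ∀ x y, IsMono x → IsMono y → r x y → r y x → x = y)
    (hdeg : ∀ x y, IsMono x → IsMono y → r x y →
      ∀ i j, y i = y j → y i ≠ 0 → x i = x j ∧ x i ≠ 0)
    (hsupp : ∀ x y, IsMono x → IsMono y → r x y → ∀ k, x k = 0 → y k = 0) :
    (∀ x, IsDist x → extOrd r x x) ∧
    (∀ x y z, IsDist x → IsDist y → IsDist z →
      extOrd r x y → extOrd r y z → extOrd r x z) ∧
    (∀ x y, IsDist x → IsDist y → extOrd r x y → extOrd r y x → x = y) ∧
    (∀ x y, IsDist x → IsDist y → ∀ σ : Equiv.Perm (Fin n),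
      extOrd r x y → extOrd r (x ∘ σ) (y ∘ σ)) := by
  refine ⟨fun x hx => ?_, ?_, ?_, ?_⟩
  · obtain ⟨σ, hσ⟩ := hx.exists_isMono_comp
    exact ⟨σ, hσ, hσ, hrefl _ hσ⟩
  · rintro x y z - - - ⟨σ, hxσ, hyσ, hxy⟩ ⟨τ, hyτ, hzτ, hyz⟩
    have hy : y ∘ σ = y ∘ τ := hyσ.comp_perm_unique hyτ
    obtain ⟨ρ, hρσ, hρτ⟩ := exists_perm_glue hy (fun c => c = 0)
    have hxρ : x ∘ ρ = x ∘ σ := by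
      funext k
      by_cases hk : y (σ k) = 0
      · simp only [Function.comp_apply, hρσ k hk]
      · have hik : y (σ (σ.symm (τ k))) = y (σ k) := by
          rw [Equiv.apply_symm_apply]
          exact (congrFun hy k).symm
        have := (hdeg _ _ hxσ hyσ hxy _ k hik (fun h => hk (hik.symm.trans h))).1
        simpa [hρτ k hk] using this
    have hzero : ∀ m, y m = 0 → z m = 0 := by
      intro m hm
      simpa using hsupp _ _ hyτ hzτ hyz (τ.symm m) (by simpa using hm)
    have hzρ : z ∘ ρ = z ∘ τ := by
      funext k
      by_cases hk : y (σ k) = 0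
      · have hk' : y (τ k) = 0 := (congrFun hy k).symm.trans hk
        simp only [Function.comp_apply, hρσ k hk, hzero _ hk, hzero _ hk']
      · simp only [Function.comp_apply, hρτ k hk]
    refine ⟨ρ, hxρ ▸ hxσ, hzρ ▸ hzτ, ?_⟩
    rw [hxρ, hzρ]
    exact htrans _ _ _ hxσ hyσ hzτ hxy (hy ▸ hyz)
  · rintro x y - - ⟨σ, hxσ, hyσ, hxy⟩ ⟨τ, hyτ, hxτ, hyx⟩
    rw [← hyσ.comp_perm_unique hyτ, ← hxσ.comp_perm_unique hxτ] at hyx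
    exact σ.surjective.injective_comp_right (hanti _ _ hxσ hyσ hxy hyx)
  · rintro x y - - σ ⟨τ, hx, hy, hxy⟩
    have key : ∀ w : Fin n → ℝ, (w ∘ σ) ∘ (τ.trans σ.symm) = w ∘ τ := by
      intro w
      funext k
      simp
    refine ⟨τ.trans σ.symm, ?_, ?_, ?_⟩ <;> simpa only [key]
end
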